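/- arXiv:1604.07196 — 4 statements merged into one kernel-verified Lean document; each statement's English description precedes it below -/
import Mathlib

section
/- Let K ≥ 2, N ≥ 2, F_s > 0, and for k = 1,…,K let z_k = e^{−d_k} e^{2πi f_k/F_s} with d_k ≥ 0 and f_k ∈ [0, F_s) pairwise distinct. Set d_max = max_{1≤k≤K} d_k and let δ be the minimum wrap-around distance between the frequencies f_k. If d_max < 1/(N−1) and δ > 84 F_s / (π (N−1)(1 − d_max(N−1))), then the smallest singular value of the Vandermonde matrix V_N ∈ ℂ^{N×K} satisfies σ_min²(V_N) ≥ (N−1)(1 − d_max(N−1)) − 84 F_s/(π δ); equivalently, for every u ∈ ℂ^K, ‖V_N u‖₂² ≥ [ (N−1)(1 − d_max(N−1)) − 84 F_s/(π δ) ] ‖u‖₂². -/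
open scoped BigOperators

/-- Euclidean (ℓ²) norm of a complex vector. -/
noncomputable def enorm2 {n : ℕ} (v : Fin n → ℂ) : ℝ := Real.sqrt (∑ i, ‖v i‖ ^ 2)

/-- Vandermonde matrix with nodes `z`, `L` rows: entry `(n, k)` is `z k ^ n`. -/
def vand {K : ℕ} (z : Fin K → ℂ) (L : ℕ) : Matrix (Fin L) (Fin K) ℂ :=
  Matrix.of fun n k => z k ^ (n : ℕ)

open Finset in
/-- A Hermitian-type quadratic form whose diagonal is at least `c` and whose off-diagonal absolute
row sums are at most `R` is bounded below by `c - R`. -/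
theorem le_re_sum_of_diag_of_row_sum {ι : Type*} [Fintype ι] [DecidableEq ι]
    (G : ι → ι → ℂ) (u : ι → ℂ) {c R : ℝ} (hdiag : ∀ k, c ≤ (G k k).re)
    (hsymm : ∀ k l, ‖G k l‖ = ‖G l k‖) (hrow : ∀ k, ∑ l ∈ univ.erase k, ‖G k l‖ ≤ R) :
    (c - R) * ∑ k, ‖u k‖ ^ 2 ≤ (∑ k, ∑ l, u k * star (u l) * G k l).re := by
  have hoff : ∑ k, ∑ l ∈ univ.erase k, ‖u k‖ * ‖u l‖ * ‖G k l‖ ≤ R * ∑ k, ‖u k‖ ^ 2 := by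
    have hswap : ∑ k, ∑ l ∈ univ.erase k, ‖u l‖ ^ 2 * ‖G k l‖
        = ∑ k, ∑ l ∈ univ.erase k, ‖u k‖ ^ 2 * ‖G k l‖ := by
      rw [sum_comm' (t' := univ) (s' := fun l => univ.erase l)]
      · exact sum_congr rfl fun k _ => sum_congr rfl fun l _ => by rw [hsymm]
      · simp [ne_comm]
    have hsq : ∑ k, ∑ l ∈ univ.erase k, ‖u k‖ ^ 2 * ‖G k l‖ ≤ R * ∑ k, ‖u k‖ ^ 2 := by
      rw [mul_sum]
      refine sum_le_sum fun k _ => ?_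
      rw [← mul_sum, mul_comm]
      exact mul_le_mul_of_nonneg_right (hrow k) (by positivity)
    have hamgm : ∑ k, ∑ l ∈ univ.erase k, ‖u k‖ * ‖u l‖ * ‖G k l‖
        ≤ ∑ k, ∑ l ∈ univ.erase k,
          (‖u k‖ ^ 2 * ‖G k l‖ / 2 + ‖u l‖ ^ 2 * ‖G k l‖ / 2) := by
      refine sum_le_sum fun k _ => sum_le_sum fun l _ => ?_
      nlinarith [mul_nonneg (sq_nonneg (‖u k‖ - ‖u l‖)) (norm_nonneg (G k l))]
    simp only [sum_add_distrib, ← sum_div] at hamgm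
    linarith
  have hterm : ∀ k, c * ‖u k‖ ^ 2 - ∑ l ∈ univ.erase k, ‖u k‖ * ‖u l‖ * ‖G k l‖
      ≤ (∑ l, u k * star (u l) * G k l).re := by
    intro k
    rw [← add_sum_erase _ _ (mem_univ k), Complex.add_re]
    have h1 : c * ‖u k‖ ^ 2 ≤ (u k * star (u k) * G k k).re := by
      have : u k * star (u k) = ((‖u k‖ ^ 2 : ℝ) : ℂ) := by
        simpa using Complex.mul_conj' (u k)
      rw [this, Complex.re_ofReal_mul, mul_comm]
      exact mul_le_mul_of_nonneg_left (hdiag k) (by positivity)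
    have h2 : -∑ l ∈ univ.erase k, ‖u k‖ * ‖u l‖ * ‖G k l‖
        ≤ (∑ l ∈ univ.erase k, u k * star (u l) * G k l).re := by
      refine (abs_le.1 ((Complex.abs_re_le_norm _).trans ((norm_sum_le _ _).trans ?_))).1
      exact sum_le_sum fun l _ => by simp
    linarith
  have := sum_le_sum fun k (_ : k ∈ univ) => hterm k
  rw [sum_sub_distrib, ← mul_sum, ← Complex.re_sum] at this
  linarith

open Finset in
/-- Averaging the energy of an exponential sum over windows, expanded as a quadratic form. -/
theorem sum_sum_norm_sq_eq {ι : Type*} [Fintype ι] (u z : ι → ℂ) (h L : ℕ) :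
    ((∑ a ∈ range h, ∑ b ∈ range L, ‖∑ k, z k ^ (a + b) * u k‖ ^ 2 : ℝ) : ℂ)
      = ∑ k, ∑ l, u k * star (u l) *
        ((∑ a ∈ range h, (z k * star (z l)) ^ a) * ∑ b ∈ range L, (z k * star (z l)) ^ b) := by
  have hsq : ∀ n : ℕ, ((‖∑ k, z k ^ n * u k‖ ^ 2 : ℝ) : ℂ)
      = ∑ k, ∑ l, u k * star (u l) * (z k * star (z l)) ^ n := by
    intro n
    have := Complex.mul_conj' (∑ k, z k ^ n * u k)
    push_cast
    rw [← this, map_sum, sum_mul_sum]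
    refine sum_congr rfl fun k _ => sum_congr rfl fun l _ => ?_
    simp only [map_mul, map_pow, Complex.star_def]
    ring
  rw [Complex.ofReal_sum]
  simp_rw [Complex.ofReal_sum, hsq, sum_mul_sum, mul_sum, ← pow_add]
  calc _ = ∑ a ∈ range h, ∑ k, ∑ b ∈ range L, ∑ l,
        u k * star (u l) * (z k * star (z l)) ^ (a + b) :=
        sum_congr rfl fun a _ => sum_comm
    _ = ∑ k, ∑ a ∈ range h, ∑ b ∈ range L, ∑ l,
        u k * star (u l) * (z k * star (z l)) ^ (a + b) := sum_comm
    _ = ∑ k, ∑ a ∈ range h, ∑ l, ∑ b ∈ range L,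
        u k * star (u l) * (z k * star (z l)) ^ (a + b) :=
        sum_congr rfl fun k _ => sum_congr rfl fun a _ => sum_comm
    _ = _ := sum_congr rfl fun k _ => sum_comm

open Finset in
theorem sum_range_sum_range_add_le {c : ℕ → ℝ} (hc : ∀ n, 0 ≤ c n) {h L N : ℕ}
    (hN : h + L = N + 1) :
    ∑ a ∈ range h, ∑ b ∈ range L, c (a + b) ≤ h * ∑ n ∈ range N, c n := by
  have : ∀ a ∈ range h, ∑ b ∈ range L, c (a + b) ≤ ∑ n ∈ range N, c n := by
    intro a ha
    rw [mem_range] at ha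
    have := sum_Ico_eq_sum_range c a (a + L)
    rw [Nat.add_sub_cancel_left] at this
    rw [← this]
    refine sum_le_sum_of_subset_of_nonneg (fun n hn => ?_) fun _ _ _ => hc _
    rw [mem_Ico] at hn
    rw [mem_range]
    omega
  simpa using sum_le_sum this

theorem norm_one_sub_mul_exp_sq_ge {ρ y : ℝ} (hρ : 0 ≤ ρ) (hy : |y| ≤ 1 / 2) :
    16 * ρ * y ^ 2 ≤ ‖1 - (ρ : ℂ) * Complex.exp ((2 * Real.pi * y : ℝ) * Complex.I)‖ ^ 2 := by
  have hπ := Real.pi_pos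
  have hcos : Real.cos (2 * Real.pi * y) ≤ 1 - 8 * y ^ 2 := by
    have h := Real.cos_le_one_sub_mul_cos_sq (x := 2 * Real.pi * y) (by
      rw [abs_mul, abs_of_pos (by positivity)]; nlinarith)
    have : 2 / Real.pi ^ 2 * (2 * Real.pi * y) ^ 2 = 8 * y ^ 2 := by field_simp; ring
    linarith
  rw [← Complex.normSq_eq_norm_sq, Complex.normSq_apply]
  simp only [Complex.sub_re, Complex.sub_im, Complex.one_re, Complex.one_im,
    Complex.re_ofReal_mul, Complex.im_ofReal_mul, Complex.exp_ofReal_mul_I_re,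
    Complex.exp_ofReal_mul_I_im]
  nlinarith [Real.sin_sq_add_cos_sq (2 * Real.pi * y), sq_nonneg (1 - ρ),
    mul_le_mul_of_nonneg_left hcos hρ,
    congrArg (ρ ^ 2 * ·) (Real.sin_sq_add_cos_sq (2 * Real.pi * y))]

open Finset in
theorem norm_geom_sum_mul_geom_sum_le {ζ : ℂ} (hζ : ‖ζ‖ ≤ 1) (h1 : ζ ≠ 1) (h L : ℕ) :
    ‖(∑ a ∈ range h, ζ ^ a) * ∑ b ∈ range L, ζ ^ b‖ ≤ 4 / ‖1 - ζ‖ ^ 2 := by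
  have hpos : 0 < ‖1 - ζ‖ := norm_pos_iff.2 (sub_ne_zero.2 h1.symm)
  have key : ∀ n : ℕ, ‖∑ a ∈ range n, ζ ^ a‖ ≤ 2 / ‖1 - ζ‖ := by
    intro n
    rw [le_div_iff₀ hpos, ← norm_mul, geom_sum_mul_neg]
    refine (norm_sub_le _ _).trans ?_
    have : ‖ζ ^ n‖ ≤ 1 := by rw [norm_pow]; exact pow_le_one₀ (norm_nonneg _) hζ
    rw [norm_one]
    linarith
  rw [norm_mul]
  calc _ ≤ (2 / ‖1 - ζ‖) * (2 / ‖1 - ζ‖) :=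
        mul_le_mul (key h) (key L) (norm_nonneg _) (by positivity)
    _ = _ := by rw [div_mul_div_comm, sq]; norm_num

theorem sum_one_div_int_sq_le {ι : Type*} (s : Finset ι) {m : ι → ℤ} (hm : Set.InjOn m s) :
    ∑ i ∈ s, 1 / (m i : ℝ) ^ 2 ≤ 4 := by
  classical
  have hsum : HasSum (fun n : ℤ => 1 / (n : ℝ) ^ 2) (Real.pi ^ 2 / 6 + Real.pi ^ 2 / 6 - 0) := by
    have := HasSum.of_nat_of_neg (f := fun n : ℤ => 1 / (n : ℝ) ^ 2)
      (by simpa using hasSum_zeta_two) (by simpa using hasSum_zeta_two)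
    simpa using this
  rw [← Finset.sum_image (f := fun n : ℤ => 1 / (n : ℝ) ^ 2) hm]
  refine (sum_le_hasSum _ (fun _ _ => by positivity) hsum).trans ?_
  nlinarith [Real.pi_lt_d2, Real.pi_pos]

/-- Inverse squares of `Δ`-separated reals which are `Δ`-separated from `0`. -/
theorem sum_one_div_sq_le_of_separated {ι : Type*} (s : Finset ι) {y : ι → ℝ} {Δ : ℝ}
    (hΔ : 0 < Δ) (h0 : ∀ i ∈ s, Δ ≤ |y i|)
    (hsep : ∀ i ∈ s, ∀ j ∈ s, i ≠ j → Δ ≤ |y i - y j|) :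
    ∑ i ∈ s, 1 / y i ^ 2 ≤ 16 / Δ ^ 2 := by
  have hinj : Set.InjOn (fun i => ⌊y i / Δ⌋) s := by
    intro i hi j hj hij
    by_contra hne
    have h := Int.abs_sub_lt_one_of_floor_eq_floor hij
    rw [← sub_div, abs_div, abs_of_pos hΔ, div_lt_one hΔ] at h
    exact absurd h (not_lt.2 (hsep i hi j hj hne))
  calc ∑ i ∈ s, 1 / y i ^ 2 ≤ ∑ i ∈ s, 4 / Δ ^ 2 * (1 / (⌊y i / Δ⌋ : ℝ) ^ 2) := by
        refine Finset.sum_le_sum fun i hi => ?_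
        have hy : 1 ≤ |y i / Δ| := by
          rw [abs_div, abs_of_pos hΔ, one_le_div hΔ]; exact h0 i hi
        have hle := Int.floor_le (y i / Δ)
        have hlt := Int.lt_floor_add_one (y i / Δ)
        have hm0 : (⌊y i / Δ⌋ : ℝ) ≠ 0 := by
          intro h
          rw [h] at hle hlt
          rw [abs_of_nonneg hle] at hy
          linarith
        have hm : |(⌊y i / Δ⌋ : ℝ)| ≤ 2 * |y i / Δ| := by
          have : |(⌊y i / Δ⌋ : ℝ)| ≤ |y i / Δ| + 1 := by
            rw [abs_le]
            constructor <;> linarith [le_abs_self (y i / Δ), neg_abs_le (y i / Δ)]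
          linarith
        have hsq := pow_le_pow_left₀ (abs_nonneg _) hm 2
        rw [mul_pow, sq_abs, sq_abs, div_pow] at hsq
        have hyi : 0 < y i ^ 2 := by
          have := hΔ.trans_le (h0 i hi)
          exact pow_pos this 2 |>.trans_eq (sq_abs _)
        rw [div_mul_div_comm, mul_one, div_le_div_iff₀ hyi (by positivity)]
        have hmul : y i ^ 2 / Δ ^ 2 * Δ ^ 2 = y i ^ 2 := by field_simp
        nlinarith [mul_le_mul_of_nonneg_left hsq (sq_nonneg Δ)]
    _ ≤ 4 / Δ ^ 2 * 4 := by
        rw [← Finset.mul_sum]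
        exact mul_le_mul_of_nonneg_left (sum_one_div_int_sq_le s hinj) (by positivity)
    _ = 16 / Δ ^ 2 := by ring

open Finset in
/-- Windowed energy of a damped exponential sum: nodes `exp (-d k) * exp (2 π i x k)` with
`0 ≤ d k ≤ D ≤ 1` and frequencies `x k` that are `Δ`-separated modulo `1`. -/
theorem le_sum_sum_norm_sq_damped {ι : Type*} [Fintype ι] [DecidableEq ι] (u z : ι → ℂ)
    {d x : ι → ℝ} {D Δ : ℝ} (hΔ : 0 < Δ) (hd : ∀ k, 0 ≤ d k) (hD : ∀ k, d k ≤ D) (hD1 : D ≤ 1)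
    (hz : ∀ k, z k = (Real.exp (-d k) : ℂ) * Complex.exp ((2 * Real.pi * x k : ℝ) * Complex.I))
    (hsep : ∀ k l, k ≠ l → ∀ n : ℤ, Δ ≤ |x k - x l + n|) (h L : ℕ) :
    (h * L * (1 - D * ((h : ℝ) + L - 2)) - 32 / Δ ^ 2) * ∑ k, ‖u k‖ ^ 2
      ≤ ∑ a ∈ range h, ∑ b ∈ range L, ‖∑ k, z k ^ (a + b) * u k‖ ^ 2 := by
  rw [← Complex.ofReal_re (∑ a ∈ range h, ∑ b ∈ range L, ‖∑ k, z k ^ (a + b) * u k‖ ^ 2),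
    sum_sum_norm_sq_eq]
  have hzz : ∀ k l, z k * star (z l) = (Real.exp (-(d k + d l)) : ℂ) *
      Complex.exp ((2 * Real.pi * (x k - x l - round (x k - x l)) : ℝ) * Complex.I) := by
    intro k l
    have hstar : star (z l) = (Real.exp (-d l) : ℂ) *
        Complex.exp (-((2 * Real.pi * x l : ℝ) * Complex.I)) := by
      rw [hz l, Complex.star_def, map_mul, Complex.conj_ofReal, ← Complex.exp_conj, map_mul,
        Complex.conj_ofReal, Complex.conj_I, mul_neg]
    have hper : Complex.exp ((2 * Real.pi * (x k - x l - round (x k - x l)) : ℝ) * Complex.I)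
        = Complex.exp ((2 * Real.pi * x k : ℝ) * Complex.I) *
          Complex.exp (-((2 * Real.pi * x l : ℝ) * Complex.I)) := by
      rw [← Complex.exp_add, Complex.exp_eq_exp_iff_exists_int]
      refine ⟨-round (x k - x l), ?_⟩
      push_cast
      ring
    rw [hper, hstar, hz k, neg_add, Real.exp_add]
    push_cast
    ring
  refine le_re_sum_of_diag_of_row_sum _ u (fun k => ?_) (fun k l => ?_) fun k => ?_
  · have hkk : z k * star (z k) = (Real.exp (-(d k + d k)) : ℂ) := by rw [hzz]; simp
    rw [hkk]
    have hpow : ∀ n : ℕ, 1 - 2 * D * n ≤ Real.exp (-(d k + d k)) ^ n := by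
      intro n
      rw [← Real.exp_nat_mul]
      refine le_trans ?_ (Real.add_one_le_exp _)
      nlinarith [mul_le_mul_of_nonneg_right (hD k) (Nat.cast_nonneg (α := ℝ) n)]
    have hgauss : ∀ n : ℕ, ∑ i ∈ range n, (i : ℝ) = n * ((n : ℝ) - 1) / 2 := by
      intro n
      induction n with
      | zero => simp
      | succ n ih => rw [sum_range_succ, ih]; push_cast; ring
    rw [sum_mul_sum]
    simp_rw [← pow_add]
    have hre : (∑ a ∈ range h, ∑ b ∈ range L, (Real.exp (-(d k + d k)) : ℂ) ^ (a + b)).re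
        = ∑ a ∈ range h, ∑ b ∈ range L, Real.exp (-(d k + d k)) ^ (a + b) := by
      norm_cast
    rw [hre]
    calc _ = ∑ a ∈ range h, ∑ b ∈ range L, (1 - 2 * D * ((a + b : ℕ) : ℝ)) := by
          push_cast
          simp only [sum_sub_distrib, mul_add, sum_add_distrib, ← mul_sum, hgauss, sum_const,
            card_range, nsmul_eq_mul]
          ring
      _ ≤ _ := sum_le_sum fun a _ => sum_le_sum fun b _ => hpow _
  · rw [← norm_star]
    simp only [star_mul', star_sum, star_pow, star_star, mul_comm (z l)]
  · set y : ι → ℝ := fun l => x k - x l - round (x k - x l) with hy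
    have hyΔ : ∀ l ∈ univ.erase k, Δ ≤ |y l| := by
      intro l hl
      have := hsep k l (ne_of_mem_erase hl).symm (-round (x k - x l))
      simpa [hy, sub_eq_add_neg] using this
    have hbound : ∀ l ∈ univ.erase k, ‖(∑ a ∈ range h, (z k * star (z l)) ^ a) *
        ∑ b ∈ range L, (z k * star (z l)) ^ b‖ ≤ 2 * (1 / y l ^ 2) := by
      intro l hl
      have hy2 : 0 < y l ^ 2 := by
        have := hΔ.trans_le (hyΔ l hl)
        exact (pow_pos this 2).trans_eq (sq_abs _)
      have hρ : 1 / 8 ≤ Real.exp (-(d k + d l)) := by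
        have h1 : Real.exp 2 ≤ 8 := by
          have : Real.exp 2 = Real.exp 1 * Real.exp 1 := by rw [← Real.exp_add]; norm_num
          rw [this]
          nlinarith [Real.exp_one_lt_d9, Real.exp_pos 1]
        calc (1 : ℝ) / 8 ≤ 1 / Real.exp 2 := one_div_le_one_div_of_le (Real.exp_pos 2) h1
          _ = Real.exp (-2) := by rw [Real.exp_neg, one_div]
          _ ≤ _ := Real.exp_le_exp.2 (by linarith [hD k, hD l])
      have hlow := norm_one_sub_mul_exp_sq_ge (ρ := Real.exp (-(d k + d l))) (y := y l)
        (Real.exp_pos _).le (abs_sub_round _)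
      rw [← hzz k l] at hlow
      have hlow' : 2 * y l ^ 2 ≤ ‖1 - z k * star (z l)‖ ^ 2 := by nlinarith
      have hle1 : ‖z k * star (z l)‖ ≤ 1 := by
        rw [hzz, norm_mul, Complex.norm_exp_ofReal_mul_I, mul_one, Complex.norm_real,
          Real.norm_of_nonneg (Real.exp_pos _).le, Real.exp_le_one_iff]
        linarith [hd k, hd l]
      have hne : z k * star (z l) ≠ 1 := by
        intro h1
        rw [h1, sub_self, norm_zero] at hlow'
        linarith
      refine (norm_geom_sum_mul_geom_sum_le hle1 hne h L).trans ?_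
      refine (div_le_div_of_nonneg_left (by norm_num) (by positivity) hlow').trans_eq ?_
      field_simp
      norm_num
    refine (sum_le_sum hbound).trans ?_
    rw [← mul_sum]
    have := sum_one_div_sq_le_of_separated (univ.erase k) hΔ hyΔ fun i _ j _ hij => by
      have := hsep j i hij.symm (round (x k - x j) - round (x k - x i))
      push_cast at this
      convert this using 2
      simp only [hy]
      ring
    linarith [show 32 / Δ ^ 2 = 2 * (16 / Δ ^ 2) by ring]

theorem enorm2_sq {n : ℕ} (v : Fin n → ℂ) : enorm2 v ^ 2 = ∑ i, ‖v i‖ ^ 2 :=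
  Real.sq_sqrt (Finset.sum_nonneg fun _ _ => by positivity)

/-- Lower bound on the squared smallest singular value of the Vandermonde matrix with
nodes `z k = exp (-(d k)) * exp (2 π i (f k) / Fs)` inside the unit disk, stated in the
equivalent vector form: `‖V_N u‖₂² ≥ [(N−1)(1 − d_max(N−1)) − 84 F_s/(π δ)] ‖u‖₂²`. -/
theorem vandermonde_sigma_min_lower_bound
    (K N : ℕ) (hK : 2 ≤ K) (hN : 2 ≤ N)
    (Fs : ℝ) (hFs : 0 < Fs)
    (d f : Fin K → ℝ) (hd : ∀ k, 0 ≤ d k)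
    (hf : ∀ k, 0 ≤ f k ∧ f k < Fs) (hfinj : Function.Injective f)
    (z : Fin K → ℂ)
    (hz : ∀ k, z k = Real.exp (-(d k)) * Complex.exp (2 * Real.pi * Complex.I * (f k) / Fs))
    (dmax : ℝ) (hdmax : IsGreatest (Set.range d) dmax)
    (δ : ℝ)
    (hδ : IsLeast {x : ℝ | ∃ (n : ℤ) (k l : Fin K), k ≠ l ∧ x = |f k - f l + n * Fs|} δ)
    (hdmax_small : dmax < 1 / ((N : ℝ) - 1))
    (hδ_large : 84 * Fs / (Real.pi * ((N : ℝ) - 1) * (1 - dmax * ((N : ℝ) - 1))) < δ) :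
    ∀ u : Fin K → ℂ,
      (((N : ℝ) - 1) * (1 - dmax * ((N : ℝ) - 1)) - 84 * Fs / (Real.pi * δ))
          * enorm2 u ^ 2
        ≤ enorm2 ((vand z N).mulVec u) ^ 2 := by
  intro u
  have hM : (1 : ℝ) ≤ (N : ℝ) - 1 := by
    have : (2 : ℝ) ≤ N := by exact_mod_cast hN
    linarith
  have hDM : dmax * ((N : ℝ) - 1) < 1 := by rwa [lt_div_iff₀ (by linarith)] at hdmax_small
  have hD : ∀ k, d k ≤ dmax := fun k => hdmax.2 ⟨k, rfl⟩
  have hD0 : 0 ≤ dmax := (hd ⟨0, by omega⟩).trans (hD _)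
  have hD1 : dmax ≤ 1 := by nlinarith
  have hq0 : 0 < 1 - dmax * ((N : ℝ) - 1) := by linarith
  have hq1 : 1 - dmax * ((N : ℝ) - 1) ≤ 1 := by nlinarith
  have hπ := Real.pi_pos
  have hδ0 : 0 < δ := lt_trans (by positivity) hδ_large
  set M : ℝ := (N : ℝ) - 1 with hMdef
  set q : ℝ := 1 - dmax * M with hq
  set Δ : ℝ := δ / Fs with hΔdef
  have hΔ : 0 < Δ := by positivity
  have hratio : 84 * Fs / (Real.pi * δ) = 84 / Real.pi / Δ := by
    rw [hΔdef]; field_simp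
  have hπ21 : 21 ≤ 84 / Real.pi := by
    rw [le_div_iff₀ hπ]; linarith [Real.pi_lt_four]
  have hMq : 84 / Real.pi / Δ < M * q := by
    rw [← hratio, div_lt_iff₀ (by positivity)]
    rw [div_lt_iff₀ (by positivity)] at hδ_large
    linarith
  have hMΔ : 21 / Δ ≤ M := by
    have : 21 / Δ ≤ 84 / Real.pi / Δ := by gcongr
    nlinarith
  set h : ℕ := ⌈4 / Δ⌉₊ with hh
  have hh_ge : 4 / Δ ≤ h := Nat.le_ceil _
  have hh_lt : (h : ℝ) < 4 / Δ + 1 := Nat.ceil_lt_add_one (by positivity)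
  have hh_pos : (0 : ℝ) < h := lt_of_lt_of_le (by positivity) hh_ge
  have hhN : h ≤ N + 1 := by
    have h4 : 4 / Δ ≤ 21 / Δ := by gcongr; norm_num
    have : (h : ℝ) ≤ (N + 1 : ℕ) := by push_cast; linarith
    exact_mod_cast this
  obtain ⟨L, hL⟩ := Nat.exists_eq_add_of_le hhN
  have hLr : (h : ℝ) + L = M + 2 := by
    have : ((N + 1 : ℕ) : ℝ) = (h + L : ℕ) := by rw [hL]
    push_cast at this
    linarith
  have hwin := le_sum_sum_norm_sq_damped u z (d := d) (x := fun k => f k / Fs) hΔ hd hD hD1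
    (fun k => by rw [hz k]; push_cast; congr 2; ring)
    (fun k l hkl n => by
      have hmem := hδ.2 ⟨n, k, l, hkl, rfl⟩
      rw [hΔdef, div_le_iff₀ hFs, ← abs_of_pos hFs, ← abs_mul, abs_of_pos hFs]
      refine hmem.trans_eq (congrArg abs ?_)
      rw [add_mul, sub_mul, div_mul_cancel₀ _ hFs.ne', div_mul_cancel₀ _ hFs.ne']) h L
  have hshift := sum_range_sum_range_add_le (c := fun n => ‖∑ k, z k ^ n * u k‖ ^ 2)
    (fun _ => by positivity) hL.symm
  have hV : enorm2 ((vand z N).mulVec u) ^ 2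
      = ∑ n ∈ Finset.range N, ‖∑ k, z k ^ n * u k‖ ^ 2 := by
    rw [enorm2_sq, Finset.sum_range]
    rfl
  rw [hV, enorm2_sq, hratio]
  refine le_of_mul_le_mul_left (le_trans ?_ (hwin.trans hshift)) hh_pos
  rw [← mul_assoc]
  refine mul_le_mul_of_nonneg_right ?_ (by positivity)
  have hq' : 1 - dmax * ((h : ℝ) + L - 2) = q := by rw [hLr, hq]; ring
  have h32 : 32 / Δ ^ 2 ≤ h * (8 / Δ) := by
    calc 32 / Δ ^ 2 = 4 / Δ * (8 / Δ) := by field_simp; norm_num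
      _ ≤ _ := by gcongr
  have hLq : M * q - 4 / Δ ≤ L * q := by
    have : M - 4 / Δ ≤ L := by linarith
    nlinarith [mul_le_mul_of_nonneg_right this hq0.le, show 0 < 4 / Δ by positivity]
  have h12 : 4 / Δ + 8 / Δ ≤ 84 / Real.pi / Δ := by
    rw [← add_div]; gcongr; linarith
  rw [hq']
  calc h * (M * q - 84 / Real.pi / Δ) ≤ h * (L * q - 8 / Δ) :=
        mul_le_mul_of_nonneg_left (by linarith) hh_pos.le
    _ ≤ _ := by linarith
end

section
/- Let K ≥ 1, N ≥ 2K, K ≤ L ≤ N−K+1, nodes z_1,…,z_K ∈ ℂ nonzero and pairwise distinct, weights α_1,…,α_K ∈ ℂ all nonzero, and x_n = Σ_{k=1}^K α_k z_k^n for n = 0,…,N−1. Then the Hankel matrix X = H_L(x_0,…,x_{N−1}) ∈ ℂ^{L×(N−L+1)} has rank exactly K. -/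
open scoped BigOperators

/-- Hankel matrix with `L` rows and `M` columns built from the sequence `x`:
entry `(i, j)` is `x (i + j)`.  For `x_0, …, x_{N-1}` take `M = N - L + 1`. -/
def hankel (L M : ℕ) (x : ℕ → ℂ) : Matrix (Fin L) (Fin M) ℂ :=
  Matrix.of fun i j => x ((i : ℕ) + (j : ℕ))

/-- Vandermonde factorization of the Hankel matrix of a sum of exponentials. -/
theorem hankel_exponential_sum_eq_mul {K : ℕ} (L M : ℕ) (z α : Fin K → ℂ) :
    hankel L M (fun n => ∑ k, α k * z k ^ n) =
      (Matrix.of fun (i : Fin L) k => z k ^ (i : ℕ)) *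
        (Matrix.diagonal α * Matrix.of fun k (j : Fin M) => z k ^ (j : ℕ)) := by
  ext i j
  rw [Matrix.mul_apply]
  simp only [hankel, Matrix.of_apply, Matrix.diagonal_mul]
  exact Finset.sum_congr rfl fun k _ => by ring

theorem det_hankel_exponential_sum_ne_zero {K : ℕ} {z α : Fin K → ℂ}
    (hz : Function.Injective z) (hα : ∀ k, α k ≠ 0) :
    (hankel K K (fun n => ∑ k, α k * z k ^ n)).det ≠ 0 := by
  have hV : (Matrix.vandermonde z).det ≠ 0 := Matrix.det_vandermonde_ne_zero_iff.mpr hz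
  have h : hankel K K (fun n => ∑ k, α k * z k ^ n) =
      (Matrix.vandermonde z).transpose * (Matrix.diagonal α * Matrix.vandermonde z) :=
    hankel_exponential_sum_eq_mul K K z α
  rw [h, Matrix.det_mul, Matrix.det_mul, Matrix.det_transpose, Matrix.det_diagonal]
  exact mul_ne_zero hV (mul_ne_zero (Finset.prod_ne_zero_iff.mpr fun k _ => hα k) hV)

theorem rank_hankel_exponential_sum {K L M : ℕ} (hL : K ≤ L) (hM : K ≤ M) {z α : Fin K → ℂ}
    (hz : Function.Injective z) (hα : ∀ k, α k ≠ 0) :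
    (hankel L M (fun n => ∑ k, α k * z k ^ n)).rank = K := by
  apply le_antisymm
  · rw [hankel_exponential_sum_eq_mul]
    exact (Matrix.rank_mul_le_left _ _).trans (Matrix.rank_le_width _)
  · have h := Matrix.rank_submatrix_le (hankel L M fun n => ∑ k, α k * z k ^ n)
      (Fin.castLE hL) (Fin.castLE hM)
    have hsub : (hankel L M fun n => ∑ k, α k * z k ^ n).submatrix
        (Fin.castLE hL) (Fin.castLE hM) = hankel K K fun n => ∑ k, α k * z k ^ n := rfl
    rwa [hsub, Matrix.rank_of_det_ne_zero (det_hankel_exponential_sum_ne_zero hz hα),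
      Fintype.card_fin] at h

/-- The Hankel matrix `X = H_L(x_0,…,x_{N−1})` of the signal
`x n = ∑ k, α k * z k ^ n`, with nonzero pairwise distinct nodes and nonzero
weights, has rank exactly `K` whenever `N ≥ 2K` and `K ≤ L ≤ N − K + 1`. -/
theorem hankel_rank_eq
    (K N L : ℕ) (hK : 1 ≤ K) (hN : 2 * K ≤ N) (hKL : K ≤ L) (hLN : L ≤ N - K + 1)
    (z α : Fin K → ℂ)
    (hz0 : ∀ k, z k ≠ 0) (hzinj : Function.Injective z)
    (hα : ∀ k, α k ≠ 0) :
    (hankel L (N - L + 1) (fun n => ∑ k, α k * z k ^ n)).rank = K := by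
  exact rank_hankel_exponential_sum hKL (by omega) hzinj hα
end

section
/- Let K ≥ 1 and L ≥ K+1, let z_1,…,z_K ∈ ℂ be pairwise distinct, let V_L ∈ ℂ^{L×K} be the associated Vandermonde matrix, and let P ∈ ℂ^{K×K} be invertible. Set S = V_L P, and let S↓ ∈ ℂ^{(L−1)×K} and S↑ ∈ ℂ^{(L−1)×K} consist of the first L−1 rows and the last L−1 rows of S, respectively, and J = diag(z_1,…,z_K). Then (i) S↑ = S↓ (P^{−1} J P), and (ii) for every Φ ∈ ℂ^{K×K} with S↓ Φ = S↑, one has Φ = P^{−1} J P, and the multiset of eigenvalues of Φ (the roots of its characteristic polynomial, counted with multiplicity) equals {z_1,…,z_K}. -/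
open scoped BigOperators

/-- Dropping the first row of a Vandermonde matrix multiplies column `k` by the node `z k`. -/
theorem vand_submatrix_eq_mul_diagonal {K : ℕ} (z : Fin K → ℂ) {L M : ℕ} (f : Fin M → Fin L)
    (hf : ∀ i, (f i : ℕ) = i + 1) :
    (vand z L).submatrix f id = vand z M * Matrix.diagonal z := by
  ext i k
  simp [vand, hf, Matrix.mul_diagonal, pow_succ]

/-- A Vandermonde matrix with distinct nodes and at least as many rows as columns is
left cancellable. -/
theorem vand_mul_left_cancel {K M : ℕ} (hM : K ≤ M) {z : Fin K → ℂ}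
    (hz : Function.Injective z) {n : Type*} {A B : Matrix (Fin K) n ℂ}
    (h : vand z M * A = vand z M * B) : A = B := by
  have hdet : IsUnit (Matrix.vandermonde z).transpose.det := by
    rw [Matrix.det_transpose]
    exact (Matrix.det_vandermonde_ne_zero_iff.mpr hz).isUnit
  have htop : (Matrix.vandermonde z).transpose * A = (Matrix.vandermonde z).transpose * B :=
    congrArg (fun C => C.submatrix (Fin.castLE hM) id) h
  rw [← Matrix.nonsing_inv_mul_cancel_left _ A hdet, htop,
    Matrix.nonsing_inv_mul_cancel_left _ B hdet]

/-- The eigenvalues of a conjugate of `diagonal z` are the entries of `z`, with multiplicity. -/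
theorem roots_charpoly_conj_diagonal {n R : Type*} [Fintype n] [DecidableEq n] [CommRing R]
    [IsDomain R] (z : n → R) {P : Matrix n n R} (hP : IsUnit P) :
    (P⁻¹ * Matrix.diagonal z * P).charpoly.roots = Multiset.map z Finset.univ.val := by
  obtain ⟨u, rfl⟩ := hP
  rw [Matrix.charpoly_units_conj', Matrix.charpoly_diagonal,
    Finset.prod_eq_multiset_prod]
  simpa only [Multiset.map_map, Function.comp_def] using
    Polynomial.roots_multiset_prod_X_sub_C (Multiset.map z Finset.univ.val)

/-- Rotational invariance property underlying ESPRIT: if `S = V_L P` with `P`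
invertible, `S↓` and `S↑` are the first and last `L − 1` rows of `S`, and
`J = diag(z_1,…,z_K)`, then `S↑ = S↓ (P⁻¹ J P)`; moreover any `Φ` with
`S↓ Φ = S↑` equals `P⁻¹ J P`, and its eigenvalues (roots of its characteristic
polynomial, with multiplicity) are exactly `z_1,…,z_K`. -/
theorem esprit_rotational_invariance
    (K L : ℕ) (hK : 1 ≤ K) (hL : K + 1 ≤ L)
    (z : Fin K → ℂ) (hzinj : Function.Injective z)
    (P : Matrix (Fin K) (Fin K) ℂ) (hP : IsUnit P) :
    (vand z L * P).submatrix
        (fun i : Fin (L - 1) => (⟨(i : ℕ) + 1, by have := i.isLt; omega⟩ : Fin L)) id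
      = (vand z L * P).submatrix
          (fun i : Fin (L - 1) => (⟨(i : ℕ), by have := i.isLt; omega⟩ : Fin L)) id
        * (P⁻¹ * Matrix.diagonal z * P)
    ∧ ∀ Φ : Matrix (Fin K) (Fin K) ℂ,
        (vand z L * P).submatrix
            (fun i : Fin (L - 1) => (⟨(i : ℕ), by have := i.isLt; omega⟩ : Fin L)) id * Φ
          = (vand z L * P).submatrix
              (fun i : Fin (L - 1) => (⟨(i : ℕ) + 1, by have := i.isLt; omega⟩ : Fin L)) id →
        Φ = P⁻¹ * Matrix.diagonal z * P
          ∧ Φ.charpoly.roots = Multiset.map z Finset.univ.val := by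
  have hdet : IsUnit P.det := (Matrix.isUnit_iff_isUnit_det P).mp hP
  have hlast : (vand z L * P).submatrix
      (fun i : Fin (L - 1) => (⟨(i : ℕ) + 1, by have := i.isLt; omega⟩ : Fin L)) id
      = vand z (L - 1) * (Matrix.diagonal z * P) := by
    rw [← Matrix.mul_assoc, ← vand_submatrix_eq_mul_diagonal z
      (fun i : Fin (L - 1) => (⟨(i : ℕ) + 1, by have := i.isLt; omega⟩ : Fin L)) fun _ => rfl]
    rfl
  have hfirst : (vand z L * P).submatrix
      (fun i : Fin (L - 1) => (⟨(i : ℕ), by have := i.isLt; omega⟩ : Fin L)) id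
      = vand z (L - 1) * P := rfl
  rw [hlast, hfirst]
  refine ⟨by rw [Matrix.mul_assoc, Matrix.mul_assoc, Matrix.mul_nonsing_inv_cancel_left _ _ hdet],
    fun Φ hΦ => ?_⟩
  rw [Matrix.mul_assoc] at hΦ
  have hcancel := vand_mul_left_cancel (by omega) hzinj hΦ
  have hEq : Φ = P⁻¹ * Matrix.diagonal z * P := by
    rw [Matrix.mul_assoc, ← hcancel, Matrix.nonsing_inv_mul_cancel_left _ _ hdet]
  exact ⟨hEq, hEq ▸ roots_charpoly_conj_diagonal z hP⟩
end

section
/- Let K ≥ 1, N ≥ 2K, K ≤ L ≤ N−K, nodes z_1,…,z_K ∈ ℂ nonzero and pairwise distinct, weights α_1,…,α_K ∈ ℂ all nonzero, and x_n = Σ_{k=1}^K α_k z_k^n. Set X₁ = H_L(x_0,…,x_{N−2}) and X₂ = H_L(x_1,…,x_{N−1}). Suppose X₁ = S₁ Λ R₁^H with S₁ ∈ ℂ^{L×K} and R₁ ∈ ℂ^{(N−L)×K} having orthonormal columns (S₁^H S₁ = R₁^H R₁ = I_K) and Λ ∈ ℂ^{K×K} invertible. Define Ψ₁ = S₁^H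 X₁ R₁ and Ψ₂ = S₁^H X₂ R₁. Then Ψ₁ is invertible and the multiset of roots (counted with multiplicity) of the polynomial λ ↦ det(Ψ₂ − λ Ψ₁) equals {z_1,…,z_K}; equivalently, the eigenvalues of Ψ₁^{−1}Ψ₂ are exactly z_1,…,z_K. -/
open scoped BigOperators

/-- Factorization of the Hankel matrix of an exponential sum through Vandermonde matrices. -/
theorem hankel_exponential_sum {ι : Type*} [Fintype ι] [DecidableEq ι] (L M : ℕ) (z α : ι → ℂ) :
    hankel L M (fun n => ∑ k, α k * z k ^ n)
      = (Matrix.of fun (i : Fin L) k => z k ^ (i : ℕ)) * Matrix.diagonal α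
        * Matrix.of fun k (j : Fin M) => z k ^ (j : ℕ) := by
  ext i j
  simp only [hankel, Matrix.of_apply, Matrix.mul_apply (M := _ * _), Matrix.mul_diagonal]
  exact Finset.sum_congr rfl fun k _ => by rw [pow_add]; ring

/-- If `P * D * Q` is invertible, then the pencil `(P * (D * Z) * Q, P * D * Q)` with `Z` diagonal
has the diagonal entries of `Z` as its generalized eigenvalues. -/
theorem roots_charpoly_inv_mul_pencil {n F : Type*} [Fintype n] [DecidableEq n] [Field F]
    (P D Q : Matrix n n F) (z : n → F) (h : IsUnit (P * D * Q)) :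
    ((P * D * Q)⁻¹ * (P * (D * Matrix.diagonal z) * Q)).charpoly.roots
      = Multiset.map z Finset.univ.val := by
  have hPD : IsUnit (P * D) := isUnit_of_mul_isUnit_left h
  have hQ : IsUnit Q := isUnit_of_mul_isUnit_right h
  have key : (P * D * Q)⁻¹ * (P * (D * Matrix.diagonal z) * Q)
      = Q⁻¹ * (Matrix.diagonal z * Q) := by
    rw [Matrix.mul_inv_rev, ← Matrix.mul_assoc P, Matrix.mul_assoc (P * D), Matrix.mul_assoc Q⁻¹,
      Matrix.nonsing_inv_mul_cancel_left _ _ ((Matrix.isUnit_iff_isUnit_det _).1 hPD)]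
  rw [key, Matrix.charpoly_mul_comm,
    Matrix.mul_nonsing_inv_cancel_right _ _ ((Matrix.isUnit_iff_isUnit_det _).1 hQ),
    Matrix.charpoly_diagonal]
  simpa only [Multiset.map_map, Function.comp_def, Finset.prod_map_val] using
    Polynomial.roots_multiset_prod_X_sub_C (Multiset.map z Finset.univ.val)

/-- Noiseless exactness of the matrix pencil method: with `X₁ = S₁ Λ R₁ᴴ` a rank-`K`
decomposition with orthonormal columns and `Λ` invertible, the matrices
`Ψ₁ = S₁ᴴ X₁ R₁` and `Ψ₂ = S₁ᴴ X₂ R₁` satisfy: `Ψ₁` is invertible and the eigenvalues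
of `Ψ₁⁻¹ Ψ₂` (equivalently, the roots of `λ ↦ det(Ψ₂ − λΨ₁)`, with multiplicity) are
exactly the nodes `z_1, …, z_K`. -/
theorem matrix_pencil_noiseless
    (K N L : ℕ) (hK : 1 ≤ K) (hN : 2 * K ≤ N) (hKL : K ≤ L) (hLN : L ≤ N - K)
    (z α : Fin K → ℂ)
    (hz0 : ∀ k, z k ≠ 0) (hzinj : Function.Injective z)
    (hα : ∀ k, α k ≠ 0)
    (S₁ : Matrix (Fin L) (Fin K) ℂ) (hS₁ : S₁.conjTranspose * S₁ = 1)
    (R₁ : Matrix (Fin (N - L)) (Fin K) ℂ) (hR₁ : R₁.conjTranspose * R₁ = 1)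
    (Λ : Matrix (Fin K) (Fin K) ℂ) (hΛ : IsUnit Λ)
    (hX₁ : hankel L (N - L) (fun n => ∑ k, α k * z k ^ n)
            = S₁ * Λ * R₁.conjTranspose) :
    IsUnit (S₁.conjTranspose * hankel L (N - L) (fun n => ∑ k, α k * z k ^ n) * R₁)
    ∧ ((S₁.conjTranspose * hankel L (N - L) (fun n => ∑ k, α k * z k ^ n) * R₁)⁻¹
          * (S₁.conjTranspose * hankel L (N - L) (fun n => ∑ k, α k * z k ^ (n + 1)) * R₁)).charpoly.roots
        = Multiset.map z Finset.univ.val := by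
  have hΨ₁ : IsUnit
      (S₁.conjTranspose * hankel L (N - L) (fun n => ∑ k, α k * z k ^ n) * R₁) := by
    rwa [hX₁, Matrix.mul_assoc S₁, ← Matrix.mul_assoc S₁.conjTranspose, hS₁, Matrix.one_mul,
      Matrix.mul_assoc, hR₁, Matrix.mul_one]
  refine ⟨hΨ₁, ?_⟩
  have hshift : (fun n => ∑ k, α k * z k ^ (n + 1)) = fun n => ∑ k, (α k * z k) * z k ^ n := by
    funext n
    exact Finset.sum_congr rfl fun k _ => by ring
  rw [hshift]
  simp only [hankel_exponential_sum, ← Matrix.diagonal_mul_diagonal] at hΨ₁ ⊢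
  set V := (Matrix.of fun (i : Fin L) k => z k ^ (i : ℕ))
  set W := (Matrix.of fun k (j : Fin (N - L)) => z k ^ (j : ℕ))
  have hfactor (E : Matrix (Fin K) (Fin K) ℂ) :
      S₁.conjTranspose * (V * E * W) * R₁ = (S₁.conjTranspose * V) * E * (W * R₁) := by
    simp only [Matrix.mul_assoc]
  rw [hfactor] at hΨ₁ ⊢
  rw [hfactor]
  exact roots_charpoly_inv_mul_pencil _ _ _ z hΨ₁
end
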